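/- If A = C·U·P is a CUP decomposition, then the row rank profile of A equals the sequence of pivot row indices of C; that is, for each k, the rank of the first i_k + 1 rows of A is k + 1, and rows i_0, ..., i_{r-1} of A are linearly independent while any row of index i with i_k < i < i_{k+1} lies in the span of rows i_0,...,i_k. -/

import Mathlib

open Matrix

section Echelon

variable {K : Type*} [Field K] {n s : ℕ} (hs : s ≤ n) {v : Fin s → Fin n → K}

/-- The leading square block of a family of vectors in echelon form is invertible. -/
theorem isUnit_leadingBlock_of_echelon
    (hdiag : ∀ j, v j (Fin.castLE hs j) ≠ 0)
    (hupper : ∀ i j, i < j → v i (Fin.castLE hs j) = 0) :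
    IsUnit (Matrix.of fun i j => v i (Fin.castLE hs j)) := by
  rw [Matrix.isUnit_iff_isUnit_det, Matrix.det_of_isLowerTriangular (M := Matrix.of _)
    fun i j h => hupper i j h, isUnit_iff_ne_zero, Finset.prod_ne_zero_iff]
  exact fun j _ => hdiag j

theorem linearIndependent_of_echelon
    (hdiag : ∀ j, v j (Fin.castLE hs j) ≠ 0)
    (hupper : ∀ i j, i < j → v i (Fin.castLE hs j) = 0) :
    LinearIndependent K v :=
  LinearIndependent.of_comp (LinearMap.funLeft K K (Fin.castLE hs))
    (Matrix.linearIndependent_rows_iff_isUnit.2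
      (isUnit_leadingBlock_of_echelon hs hdiag hupper))

/-- Vectors in echelon form supported on the first `s` coordinates span every vector supported
there. -/
theorem mem_span_of_echelon
    (hdiag : ∀ j, v j (Fin.castLE hs j) ≠ 0)
    (hupper : ∀ i j, i < j → v i (Fin.castLE hs j) = 0)
    (hv : ∀ i, ∀ c : Fin n, s ≤ (c : ℕ) → v i c = 0)
    {w : Fin n → K} (hw : ∀ c : Fin n, s ≤ (c : ℕ) → w c = 0) :
    w ∈ Submodule.span K (Set.range v) := by
  obtain ⟨a, ha⟩ := Matrix.vecMul_surjective_iff_isUnit.2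
    (isUnit_leadingBlock_of_echelon hs hdiag hupper) fun j => w (Fin.castLE hs j)
  rw [Submodule.mem_span_range_iff_exists_fun]
  refine ⟨a, funext fun c => ?_⟩
  simp only [Finset.sum_apply, Pi.smul_apply, smul_eq_mul]
  rcases lt_or_ge (c : ℕ) s with h | h
  · exact congrFun ha ⟨c, h⟩
  · simp [hw c h, hv _ c h]

end Echelon

/-- If `A = C·U·P` is a CUP decomposition with pivot row indices
`piv 0 < … < piv (r-1)`, then the row rank profile of `A` is given by the
pivot rows of `C`: for each `k` the first `piv k + 1` rows of `A` have rank
`k + 1`, the rows `piv 0, …, piv (r-1)` of `A` are linearly independent, and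
any row of index `i` with `piv k < i` lying before all later pivots is in the
span of rows `piv 0, …, piv k`. -/
theorem cup_stmt13 {K : Type*} [Field K] {m n r : ℕ} (hr : r ≤ n)
    (A C : Matrix (Fin m) (Fin n) K) (U P : Matrix (Fin n) (Fin n) K)
    (piv : Fin r → Fin m) (hpiv : StrictMono piv)
    (hCpiv : ∀ j : Fin r, C (piv j) (Fin.castLE hr j) ≠ 0)
    (hCabove : ∀ j : Fin r, ∀ i : Fin m,
        (i : ℕ) < (piv j : ℕ) → C i (Fin.castLE hr j) = 0)
    (hCzero : ∀ c : Fin n, r ≤ (c : ℕ) → ∀ i : Fin m, C i c = 0)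
    (hUdiag : ∀ i : Fin n, U i i = 1)
    (hUtri : ∀ i j : Fin n, (j : ℕ) < (i : ℕ) → U i j = 0)
    (σ : Equiv.Perm (Fin n)) (hP : P = σ.permMatrix K)
    (hA : A = C * U * P) :
    (∀ k : Fin r,
        (A.submatrix (fun t : Fin ((piv k : ℕ) + 1) =>
          Fin.castLE (piv k).isLt t) id).rank = (k : ℕ) + 1) ∧
    LinearIndependent K (fun j : Fin r => A (piv j)) ∧
    (∀ k : Fin r, ∀ i : Fin m, (piv k : ℕ) < (i : ℕ) →
        (∀ k' : Fin r, k < k' → (i : ℕ) < (piv k' : ℕ)) →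
        A i ∈ Submodule.span K
          (Set.range fun j : Fin ((k : ℕ) + 1) =>
            A (piv (Fin.castLE k.isLt j)))) := by
  have hdet : IsUnit (U * P) := by
    refine IsUnit.mul ?_ ?_
    · rw [Matrix.isUnit_iff_isUnit_det,
        Matrix.det_of_isUpperTriangular fun i j h => hUtri i j h]
      simp [hUdiag]
    · rw [hP, Matrix.isUnit_iff_isUnit_det, Matrix.det_permutation]
      exact (Equiv.Perm.sign σ).isUnit.map (Int.castRingHom K)
  let L : (Fin n → K) →ₗ[K] (Fin n → K) := (U * P).vecMulLinear
  have hL : LinearMap.ker L = ⊥ :=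
    LinearMap.ker_eq_bot.2 (Matrix.vecMul_injective_iff_isUnit.2 hdet)
  have hrow : ∀ i, A i = L (C i) := fun i => by
    rw [hA, Matrix.mul_assoc]
    rfl
  have hindep : LinearIndependent K (fun j : Fin r => A (piv j)) := by
    simp only [hrow]
    exact (linearIndependent_of_echelon hr (v := fun j => C (piv j)) hCpiv
      fun i j h => hCabove j _ (hpiv h)).map' L hL
  have hspan : ∀ k : Fin r, ∀ i : Fin m,
      (∀ k' : Fin r, k < k' → (i : ℕ) < (piv k' : ℕ)) →
      A i ∈ Submodule.span K
        (Set.range fun j : Fin ((k : ℕ) + 1) => A (piv (Fin.castLE k.isLt j))) := by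
    intro k i hi
    have hsupp : ∀ i : Fin m, (∀ k' : Fin r, k < k' → (i : ℕ) < (piv k' : ℕ)) →
        ∀ c : Fin n, (k : ℕ) + 1 ≤ c → C i c = 0 := by
      intro i hi c hc
      rcases lt_or_ge (c : ℕ) r with h | h
      · exact hCabove ⟨c, h⟩ i (hi ⟨c, h⟩ hc)
      · exact hCzero c h i
    have hmem := mem_span_of_echelon (k.isLt.trans_le hr)
      (v := fun j : Fin ((k : ℕ) + 1) => C (piv (Fin.castLE k.isLt j)))
      (fun j => hCpiv (Fin.castLE k.isLt j))
      (fun i j h => hCabove (Fin.castLE k.isLt j) _ (hpiv h))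
      (fun j => hsupp _ fun k' hk' => hpiv (lt_of_le_of_lt (Nat.lt_succ_iff.1 j.isLt) hk'))
      (hsupp i hi)
    have hmap := Submodule.mem_map_of_mem (f := L) hmem
    rw [Submodule.map_span, ← Set.range_comp] at hmap
    simpa only [hrow, Function.comp_def] using hmap
  refine ⟨fun k => ?_, hindep, fun k i _ hi => hspan k i hi⟩
  have heq : Submodule.span K (Set.range (A.submatrix (fun t : Fin ((piv k : ℕ) + 1) =>
        Fin.castLE (piv k).isLt t) id).row) =
      Submodule.span K
        (Set.range fun j : Fin ((k : ℕ) + 1) => A (piv (Fin.castLE k.isLt j))) := by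
    apply le_antisymm <;> rw [Submodule.span_le]
    · rintro _ ⟨t, rfl⟩
      exact hspan k (Fin.castLE (piv k).isLt t) fun k' hk' =>
        lt_of_le_of_lt (Nat.lt_succ_iff.1 t.isLt) (hpiv hk')
    · rintro _ ⟨j, rfl⟩
      have hj : piv (Fin.castLE k.isLt j) ≤ piv k :=
        hpiv.monotone (Nat.lt_succ_iff.1 j.isLt)
      exact Submodule.subset_span ⟨⟨piv (Fin.castLE k.isLt j), Nat.lt_succ_iff.2 hj⟩, rfl⟩
  rw [Matrix.rank_eq_finrank_span_row, heq, finrank_span_eq_card, Fintype.card_fin]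
  exact hindep.comp _ (Fin.castLE_injective k.isLt)
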